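/- arXiv:2102.12325 — 6 statements merged into one kernel-verified Lean document; each statement's English description precedes it below -/
import Mathlib

section
/- Let X → A → ω be a stratified space over a poset A that is itself stratified over ω = {0 < 1 < 2 < ⋯} (a monotone map A → ω), with X paracompact; for each n < ω let A_{≤n} and X_{≤n} be the preimages of {0,…,n}, and assume X_{≤n} is paracompact and conically A_{≤n}-stratified and that A_{≤n} satisfies the ascending chain condition. Let X_{<ω} denote the set X endowed with the final (colimit) topology with respect to the inclusions X_{≤n} ⊆ X. Then the identity of X induces an isomorphism of simplicial sets Exit_A(X_{<ω}) ≅ Exit_A(X); in other words, the exit paths simplicial set does not depend on the global topology of X. -/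
open TopologicalSpace

universe u v w

/-- The Alexandrov (upper-set) topology on a preorder: open sets are upward closed sets. -/
def alexandrov (A : Type*) [Preorder A] : TopologicalSpace A where
  IsOpen U := IsUpperSet U
  isOpen_univ := isUpperSet_univ
  isOpen_inter _ _ h₁ h₂ := h₁.inter h₂
  isOpen_sUnion _ h := isUpperSet_sUnion h

/-- An `A`-stratified space is a continuous map to `A` with the Alexandrov topology. -/
def IsStratification {X : Type*} [tX : TopologicalSpace X] {A : Type*} [Preorder A]
    (f : X → A) : Prop :=
  @Continuous X A tX (alexandrov A) f
/-- The open cone on `L`: a cone point together with `(0,∞) × L`. -/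
def Cone (L : Type u) : Type u := Option ({t : ℝ // 0 < t} × L)

/-- The cone point. -/
def Cone.pt {L : Type u} : Cone L := none

/-- A point of the cone away from the cone point. -/
def Cone.mk {L : Type u} (t : {t : ℝ // 0 < t}) (l : L) : Cone L := some (t, l)

/-- The open-cone topology. -/
instance coneTopology (L : Type u) [TopologicalSpace L] : TopologicalSpace (Cone L) where
  IsOpen U := IsOpen {p : {t : ℝ // 0 < t} × L | Cone.mk p.1 p.2 ∈ U} ∧
    (Cone.pt ∈ U → ∃ ε > (0:ℝ), ∀ (t : {t : ℝ // 0 < t}) (l : L), (t : ℝ) < ε → Cone.mk t l ∈ U)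
  isOpen_univ := ⟨isOpen_univ, fun _ => ⟨1, one_pos, fun _ _ _ => trivial⟩⟩
  isOpen_inter U V hU hV := by
    refine ⟨hU.1.inter hV.1, fun h => ?_⟩
    obtain ⟨ε₁, hε₁, h₁⟩ := hU.2 h.1
    obtain ⟨ε₂, hε₂, h₂⟩ := hV.2 h.2
    exact ⟨min ε₁ ε₂, lt_min hε₁ hε₂, fun t l ht =>
      ⟨h₁ t l (lt_of_lt_of_le ht (min_le_left _ _)), h₂ t l (lt_of_lt_of_le ht (min_le_right _ _))⟩⟩
  isOpen_sUnion S hS := by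
    constructor
    · have he : {p : {t : ℝ // 0 < t} × L | Cone.mk p.1 p.2 ∈ ⋃₀ S} =
        ⋃ U : S, {p : {t : ℝ // 0 < t} × L | Cone.mk p.1 p.2 ∈ (U : Set (Cone L))} := by
        ext p; simp [Set.mem_sUnion]
      rw [he]
      exact isOpen_iUnion fun U => (hS U U.2).1
    · rintro ⟨U, hU, hmem⟩
      obtain ⟨ε, hε, h⟩ := (hS U hU).2 hmem
      exact ⟨ε, hε, fun t l ht => ⟨U, hU, h t l ht⟩⟩
/-- The stratification of `U × C(L)` over `A`: the cone point sits in the stratum `a`,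
and the rest is stratified by the stratification of `L`. -/
def coneStrat {L : Type*} {A : Type*} (a : A) (g : L → A) (c : Cone L) : A :=
  Option.elim c a (fun p => g p.2)

/-- `f : X → A` is a conically stratified space: every point of every stratum has an
open neighbourhood (in its stratum) admitting a conical extension. -/
def IsConicallyStratified {X : Type u} [TopologicalSpace X] {A : Type v} [PartialOrder A]
    (f : X → A) : Prop :=
  ∀ (a : A) (x : X), f x = a →
    ∃ U : Set X, x ∈ U ∧
      (∃ W : Set X, IsOpen W ∧ U = W ∩ f ⁻¹' {a}) ∧
      ∃ V : Set X, IsOpen V ∧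
        ∃ (L : TopCat.{u}) (g : ↥L → {b : A // a < b}),
          IsStratification g ∧
          ∃ h : ↥V ≃ₜ ↥U × Cone ↥L,
            ∀ v : ↥V, f v.1 = coneStrat a (fun l => (g l : A)) (h v).2
/-- The topological `p`-simplex. -/
abbrev TopSimplex (p : ℕ) : Type :=
  {t : Fin (p+1) → ℝ // (∀ i, 0 ≤ t i) ∧ ∑ i, t i = 1}

/-- The largest index whose coordinate is non-zero: the stratification of the simplex. -/
noncomputable def lastIdx {p : ℕ} (t : TopSimplex p) : Fin (p+1) :=
  (Finset.univ.filter fun i => t.1 i ≠ 0).max' (by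
    rw [Finset.filter_nonempty_iff]
    by_contra h
    push_neg at h
    have hz : ∑ i, t.1 i = 0 := Finset.sum_eq_zero fun i _ => h i (Finset.mem_univ i)
    rw [t.2.2] at hz
    exact one_ne_zero hz)

/-- A `p`-simplex of the exit paths simplicial set `Exit_A(X)`: a continuous map
`|Δᵖ| → X` such that `f ∘ σ` factors as a monotone map through the stratification
of the simplex. The topology on `X` is an explicit argument. -/
def IsExitSimplex {X : Type*} (tX : TopologicalSpace X) {A : Type*} [Preorder A]
    (f : X → A) {p : ℕ} (σ : TopSimplex p → X) : Prop :=
  @Continuous (TopSimplex p) X _ tX σ ∧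
    ∃ ψ : Fin (p+1) →o A, ∀ t : TopSimplex p, f (σ t) = ψ (lastIdx t)
/-- Let `X → A → ω` be a stratified space over a poset `A` stratified over `ω` (via the
monotone map `g : A → ℕ`), with `X` paracompact, each `X_{≤n}` paracompact and conically
`A_{≤n}`-stratified, and each `A_{≤n}` satisfying the ascending chain condition.  Then
the identity of `X` induces an isomorphism `Exit_A(X_{<ω}) ≅ Exit_A(X)`, where
`X_{<ω}` is `X` with the final (colimit) topology: a map `|Δᵖ| → X` is an exit simplex
for the colimit topology iff it is one for the original topology. -/
theorem exit_paths_colimit_topology {X : Type u} [tX : TopologicalSpace X]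
    [ParacompactSpace X] {A : Type v} [PartialOrder A]
    (g : A → ℕ) (hg : Monotone g) (f : X → A) (hf : IsStratification f)
    (hpara : ∀ n : ℕ, ParacompactSpace ↥(f ⁻¹' {a | g a ≤ n}))
    (hcon : ∀ n : ℕ, IsConicallyStratified
      (fun x : ↥(f ⁻¹' {a | g a ≤ n}) => (⟨f x.1, x.2⟩ : {a : A // g a ≤ n})))
    (hacc : ∀ n : ℕ, ¬ ∃ c : ℕ → {a : A // g a ≤ n}, StrictMono c) :
    ∀ (p : ℕ) (σ : TopSimplex p → X),
      IsExitSimplex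
        (⨆ n : ℕ, TopologicalSpace.coinduced
          (fun x : ↥(f ⁻¹' {a | g a ≤ n}) => (x : X)) inferInstance) f σ ↔
      IsExitSimplex tX f σ := by
  intro p σ
  constructor
  · rintro ⟨hc, hψ⟩
    refine ⟨?_, hψ⟩
    refine continuous_le_rng ?_ hc
    refine iSup_le fun n => ?_
    exact continuous_iff_coinduced_le.mp continuous_subtype_val
  · rintro ⟨hc, ψ, hψ⟩
    refine ⟨?_, ψ, hψ⟩
    have hmem : ∀ t, σ t ∈ f ⁻¹' {a | g a ≤ g (ψ (Fin.last p))} := fun t => by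
      change g (f (σ t)) ≤ _
      rw [hψ t]
      exact hg (ψ.monotone (Fin.le_last _))
    refine continuous_le_rng (le_iSup (fun n : ℕ => TopologicalSpace.coinduced
          (fun x : ↥(f ⁻¹' {a | g a ≤ n}) => (x : X)) inferInstance)
          (g (ψ (Fin.last p)))) ?_
    have h1 : Continuous (fun t => (⟨σ t, hmem t⟩ : ↥(f ⁻¹' {a | g a ≤ g (ψ (Fin.last p))}))) :=
      hc.subtype_mk hmem
    refine continuous_iff_coinduced_le.mpr ?_
    have h2 := coinduced_mono (f := fun x : ↥(f ⁻¹' {a | g a ≤ g (ψ (Fin.last p))}) => (x : X))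
      (continuous_iff_coinduced_le.mp h1)
    rw [coinduced_compose] at h2
    exact h2
end

section
/- Let f : X → A be a stratified space and B ⊆ A a downward-closed subposet (b ∈ B and a ≤ b imply a ∈ B), with X_B = f⁻¹(B) carrying the subspace topology and the restricted stratification over B. Then the inclusion of simplicial sets Exit_B(X_B) ⊆ Exit_A(X) is a right fibration: it has the right lifting property with respect to every horn inclusion Λⁿᵢ ⊆ Δⁿ with n ≥ 1 and 0 < i ≤ n. (Concretely, a p-simplex of Exit_A(X) whose final vertex lies in X_B lies entirely in Exit_B(X_B): if a stratified path ends in X_B, the whole path must be in X_B.) -/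
open TopologicalSpace

universe u v w

/-- The `j`-th face map of topological simplices (insert a zero coordinate at `j`). -/
def faceMap {n : ℕ} (j : Fin (n+2)) (t : TopSimplex n) : TopSimplex (n+1) :=
  ⟨j.insertNth 0 t.1, by
    constructor
    · intro i
      refine Fin.succAboveCases j ?_ ?_ i
      · simp
      · intro k
        simpa using t.2.1 k
    · rw [Fin.sum_univ_succAbove _ j]
      simp [t.2.2]⟩

/-- The topological horn `|Λⁿᵢ| ⊆ |Δⁿ|`: the union of the faces other than the `i`-th. -/
def TopHorn (n : ℕ) (i : Fin (n+1)) : Set (TopSimplex n) := {t | ∃ j, j ≠ i ∧ t.1 j = 0}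

lemma faceMap_mem_horn {n : ℕ} {i j : Fin (n+2)} (hj : j ≠ i) (t : TopSimplex n) :
    faceMap j t ∈ TopHorn (n+1) i :=
  ⟨j, hj, by simp [faceMap]⟩

/-- The `k`-th vertex of the topological simplex. -/
def simplexVertex {p : ℕ} (k : Fin (p+1)) : TopSimplex p :=
  ⟨fun j => if j = k then 1 else 0, by
    constructor
    · intro j
      by_cases h : j = k <;> simp [h]
    · simp⟩
lemma lastIdx_simplexVertex {p : ℕ} (k : Fin (p+1)) : lastIdx (simplexVertex k) = k := by
  have h := Finset.max'_mem (Finset.univ.filter fun i => (simplexVertex k).1 i ≠ 0)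
    ⟨k, by simp [simplexVertex]⟩
  have h2 := (Finset.mem_filter.1 h).2
  by_contra hne
  exact h2 (if_neg hne)

/-- Let `f : X → A` be a stratified space and `B ⊆ A` a downward-closed subposet.  Then
the inclusion `Exit_B(X_B) ⊆ Exit_A(X)` is a right fibration: it has the right lifting
property against all horn inclusions `Λⁿᵢ ⊆ Δⁿ` with `n ≥ 1` and `0 < i ≤ n`.
Concretely: an exit `n`-simplex of `X` whose restriction to the horn `Λⁿᵢ` lies in
`X_B` lies entirely in `X_B` and is an exit simplex of `X_B`; moreover any exit
`p`-simplex of `X` whose final vertex lies in `X_B` lies entirely in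
`Exit_B(X_B)`. -/
theorem exit_paths_right_fibration {X : Type u} [TopologicalSpace X]
    {A : Type v} [PartialOrder A] (f : X → A) (hf : IsStratification f)
    (B : Set A) (hB : IsLowerSet B) :
    -- right lifting property against Λⁿᵢ ⊆ Δⁿ, n ≥ 1, 0 < i ≤ n
    (∀ (m : ℕ) (i : Fin (m+2)), i ≠ 0 →
      ∀ σ : TopSimplex (m+1) → X, IsExitSimplex inferInstance f σ →
        (∀ t : TopSimplex (m+1), t ∈ TopHorn (m+1) i → σ t ∈ f ⁻¹' B) →
        ∃ hσ : ∀ t, σ t ∈ f ⁻¹' B,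
          IsExitSimplex inferInstance
            (fun x : ↥(f ⁻¹' B) => (⟨f x.1, x.2⟩ : B)) (fun t => ⟨σ t, hσ t⟩)) ∧
    -- a simplex whose final vertex lies in X_B lies entirely in Exit_B(X_B)
    (∀ (p : ℕ) (σ : TopSimplex p → X), IsExitSimplex inferInstance f σ →
      σ (simplexVertex (Fin.last p)) ∈ f ⁻¹' B →
        ∃ hσ : ∀ t, σ t ∈ f ⁻¹' B,
          IsExitSimplex inferInstance
            (fun x : ↥(f ⁻¹' B) => (⟨f x.1, x.2⟩ : B)) (fun t => ⟨σ t, hσ t⟩)) := by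
  have key : ∀ (p : ℕ) (σ : TopSimplex p → X), IsExitSimplex inferInstance f σ →
      σ (simplexVertex (Fin.last p)) ∈ f ⁻¹' B →
        ∃ hσ : ∀ t, σ t ∈ f ⁻¹' B,
          IsExitSimplex inferInstance
            (fun x : ↥(f ⁻¹' B) => (⟨f x.1, x.2⟩ : B)) (fun t => ⟨σ t, hσ t⟩) := by
    rintro p σ ⟨hc, ψ, hψ⟩ hlast
    have hl : ψ (Fin.last p) ∈ B := by
      have h : f (σ (simplexVertex (Fin.last p))) ∈ B := hlast
      rwa [hψ, lastIdx_simplexVertex] at h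
    have hall : ∀ k, ψ k ∈ B := fun k => hB (ψ.monotone (Fin.le_last k)) hl
    refine ⟨fun t => ?_, ?_, ⟨⟨fun k => ⟨ψ k, hall k⟩, fun a b hab => ψ.monotone hab⟩, ?_⟩⟩
    · change f (σ t) ∈ B
      rw [hψ]
      exact hall _
    · exact Continuous.subtype_mk hc _
    · intro t
      exact Subtype.ext (hψ t)
  refine ⟨fun m i hi σ hσ hhorn => key (m+1) σ hσ (hhorn _ ⟨0, hi.symm, ?_⟩), key⟩
  have h0 : (0 : Fin (m+2)) ≠ Fin.last (m+1) := (Fin.last_pos).ne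
  simp [simplexVertex, h0]
end

section
/- If (X, d) is a metric space, then the open cone C(X) is a metrizable topological space. -/
open TopologicalSpace

universe u v w

/-- The cone distance: `|t - s| + min t s * min 1 (d(x,y))`. -/
noncomputable def coneDist {X : Type u} [MetricSpace X] : Cone X → Cone X → ℝ
  | none, none => 0
  | none, some q => q.1.1
  | some p, none => p.1.1
  | some p, some q => |p.1.1 - q.1.1| + min p.1.1 q.1.1 * min 1 (dist p.2 q.2)

theorem coneDist_aux (t s r a b c : ℝ) (hs : 0 < s) (ht : 0 < t) (hr : 0 < r)
    (ha : 0 ≤ a) (hb : 0 ≤ b) (hc1 : c ≤ 1) (hc : c ≤ a + b) :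
    |t - r| + min t r * c ≤ (|t - s| + min t s * a) + (|s - r| + min s r * b) := by
  have hm : 0 < min t r := lt_min ht hr
  rcases le_total (min t r) s with h | h
  · have h1 : min t r ≤ min t s := le_min (min_le_left _ _) h
    have h2 : min t r ≤ min s r := le_min h (min_le_right _ _)
    have h3 := abs_sub_le t s r
    have h4 := mul_le_mul_of_nonneg_right h1 ha
    have h5 := mul_le_mul_of_nonneg_right h2 hb
    have h6 := mul_le_mul_of_nonneg_left hc hm.le
    linarith
  · have hst : s ≤ t := h.trans (min_le_left _ _)
    have hsr : s ≤ r := h.trans (min_le_right _ _)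
    rw [min_eq_right hst, min_eq_left hsr, abs_of_nonneg (sub_nonneg.2 hst),
      abs_of_nonpos (sub_nonpos.2 hsr)]
    have h6 := mul_le_mul_of_nonneg_left hc hs.le
    have h7 : (min t r - s) * c ≤ (min t r - s) * 1 :=
      mul_le_mul_of_nonneg_left hc1 (sub_nonneg.2 h)
    rcases le_total t r with k | k
    · rw [min_eq_left k] at *
      rw [abs_of_nonpos (sub_nonpos.2 k)]
      nlinarith
    · rw [min_eq_right k] at *
      rw [abs_of_nonneg (sub_nonneg.2 k)]
      nlinarith

theorem coneDist_self {X : Type u} [MetricSpace X] (p : Cone X) : coneDist p p = 0 := by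
  rcases p with _ | p <;> simp [coneDist]

theorem coneDist_comm {X : Type u} [MetricSpace X] (p q : Cone X) :
    coneDist p q = coneDist q p := by
  rcases p with _ | p <;> rcases q with _ | q <;>
    simp [coneDist, abs_sub_comm, min_comm, dist_comm]

theorem coneDist_triangle {X : Type u} [MetricSpace X] (p q r : Cone X) :
    coneDist p r ≤ coneDist p q + coneDist q r := by
  rcases p with _ | ⟨⟨t, ht⟩, x⟩ <;> rcases q with _ | ⟨⟨s, hs⟩, y⟩ <;>
    rcases r with _ | ⟨⟨r, hr⟩, z⟩ <;> simp only [coneDist]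
  · simp
  · simp
  · linarith
  · have : 0 ≤ min s r * min 1 (dist y z) := by positivity
    linarith [neg_abs_le (s - r)]
  · simp
  · have h1 : min t r * min 1 (dist x z) ≤ min t r * 1 :=
      mul_le_mul_of_nonneg_left (min_le_left _ _) (by positivity)
    rcases le_total t r with k | k
    · rw [min_eq_left k] at *
      rw [abs_of_nonpos (sub_nonpos.2 k)]
      linarith
    · rw [min_eq_right k] at *
      rw [abs_of_nonneg (sub_nonneg.2 k)]
      linarith
  · have : 0 ≤ min t s * min 1 (dist x y) := by positivity
    linarith [le_abs_self (t - s)]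
  · refine coneDist_aux t s r _ _ _ hs ht hr (by positivity) (by positivity) (min_le_left _ _) ?_
    have h := dist_triangle x y z
    have h1 : 0 ≤ dist x y := dist_nonneg
    have h2 : 0 ≤ dist y z := dist_nonneg
    rcases min_cases 1 (dist x y) with ⟨e, _⟩ | ⟨e, _⟩ <;>
      rcases min_cases 1 (dist y z) with ⟨f, _⟩ | ⟨f, _⟩ <;> rw [e, f]
    · linarith [min_le_left 1 (dist x z)]
    · linarith [min_le_left 1 (dist x z)]
    · linarith [min_le_left 1 (dist x z)]
    · linarith [min_le_right 1 (dist x z)]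

theorem coneDist_eq {X : Type u} [MetricSpace X] (p q : Cone X) (h : coneDist p q = 0) :
    p = q := by
  rcases p with _ | ⟨⟨t, ht⟩, x⟩ <;> rcases q with _ | ⟨⟨s, hs⟩, y⟩ <;> simp only [coneDist] at h
  · rfl
  · exact absurd h hs.ne'
  · exact absurd h ht.ne'
  · have h0 : 0 ≤ min t s * min 1 (dist x y) := by positivity
    have h1 : |t - s| = 0 := le_antisymm (by linarith) (abs_nonneg _)
    have h2 : min t s * min 1 (dist x y) = 0 := by linarith
    have h3 : t = s := sub_eq_zero.1 (abs_eq_zero.1 h1)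
    have h4 : min 1 (dist x y) = 0 :=
      (mul_eq_zero.1 h2).resolve_left (lt_min ht hs).ne'
    have h5 : dist x y = 0 := by
      rcases min_cases 1 (dist x y) with ⟨e, _⟩ | ⟨e, _⟩ <;> linarith
    have h6 := dist_eq_zero.1 h5
    subst h3 h6
    rfl

theorem cone_isOpen_iff {X : Type u} [MetricSpace X] (U : Set (Cone X)) :
    IsOpen U ↔ ∀ p ∈ U, ∃ ε > 0, ∀ q, coneDist p q < ε → q ∈ U := by
  constructor
  · rintro ⟨h1, h2⟩ p hp
    rcases p with _ | ⟨⟨t, ht⟩, x⟩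
    · obtain ⟨ε, hε, h⟩ := h2 hp
      refine ⟨ε, hε, ?_⟩
      rintro (_ | ⟨s, y⟩) hq
      · exact hp
      · exact h s y hq
    · obtain ⟨ε, hε, h⟩ := Metric.isOpen_iff.1 h1 (⟨t, ht⟩, x) hp
      refine ⟨min (t / 2) (min ε (min ε 1 * (t / 2))), by positivity, ?_⟩
      rintro (_ | ⟨⟨s, hs⟩, y⟩) hq <;> simp only [coneDist, lt_min_iff] at hq
      · linarith [hq.1]
      · obtain ⟨q1, q2, q3⟩ := hq
        have h0 : 0 ≤ min t s * min 1 (dist x y) := by positivity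
        have hts : t / 2 ≤ min t s := le_min (by linarith) (by linarith [le_abs_self (t - s)])
        have hm : 0 ≤ min 1 (dist x y) := by positivity
        have h3 := mul_le_mul_of_nonneg_right hts hm
        have h4 : min 1 (dist x y) * (t / 2) < min ε 1 * (t / 2) := by
          linarith [abs_nonneg (t - s)]
        have h5 := lt_of_mul_lt_mul_right h4 (by positivity)
        have h6 : dist x y < ε := by
          rcases min_cases 1 (dist x y) with ⟨e, _⟩ | ⟨e, _⟩
          · linarith [min_le_right ε 1]
          · linarith [min_le_left ε 1]
        refine @h (⟨s, hs⟩, y) ?_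
        rw [Metric.mem_ball, dist_comm, Prod.dist_eq]
        refine max_lt ?_ h6
        rw [Subtype.dist_eq, Real.dist_eq]
        change |t - s| < ε
        linarith
  · intro h
    refine ⟨?_, fun hp => ?_⟩
    · rw [Metric.isOpen_iff]
      rintro ⟨⟨t, ht⟩, x⟩ hp
      obtain ⟨ε, hε, h⟩ := h _ hp
      refine ⟨ε / (1 + t), by positivity, ?_⟩
      rintro ⟨⟨s, hs⟩, y⟩ hq
      rw [Metric.mem_ball, dist_comm, Prod.dist_eq, max_lt_iff, Subtype.dist_eq,
        Real.dist_eq] at hq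
      obtain ⟨q1, q2⟩ := hq
      change |t - s| < _ at q1
      change dist x y < _ at q2
      apply h
      change |t - s| + min t s * min 1 (dist x y) < ε
      have h1 : min t s * min 1 (dist x y) ≤ t * dist x y :=
        mul_le_mul (min_le_left _ _) (min_le_right _ _) (by positivity) ht.le
      have h2 := mul_lt_mul_of_pos_left q2 ht
      have h3 : ε / (1 + t) * (1 + t) = ε := div_mul_cancel₀ _ (by positivity)
      linarith
    · obtain ⟨ε, hε, h⟩ := h _ hp
      exact ⟨ε, hε, fun t l ht => h _ ht⟩

/-- If `X` is a metric space, then the open cone `C(X)` is metrizable. -/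
theorem cone_metrizable (X : Type u) [MetricSpace X] :
    TopologicalSpace.MetrizableSpace (Cone X) := by
  letI : MetricSpace (Cone X) := MetricSpace.ofDistTopology coneDist coneDist_self
    coneDist_comm coneDist_triangle cone_isOpen_iff coneDist_eq
  exact (inferInstance : TopologicalSpace.MetrizableSpace (Cone X))
end

section
/- Let X be a topological space and X₀ ⊆ X₁ ⊆ ⋯ ⊆ X an increasing sequence of closed subsets with ⋃ₙ Xₙ = X, such that X carries the final (colimit) topology with respect to the inclusions (a set C ⊆ X is closed iff C ∩ Xₙ is closed in Xₙ for every n) and each Xₙ with the subspace topology is T₁. Then every sequence (x_k) that converges in X is bounded in the filtration: there exists p such that x_k ∈ X_p for all k. -/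
open TopologicalSpace

universe u v w

/-- Let `X` carry the final (colimit) topology with respect to an increasing sequence of
closed subsets `X₀ ⊆ X₁ ⊆ ⋯` covering `X`, each of which is T₁ in the subspace
topology.  Then every convergent sequence in `X` is bounded in the filtration. -/
theorem convergent_seq_bounded {X : Type u} [TopologicalSpace X] (F : ℕ → Set X)
    (hmono : Monotone F) (hclosed : ∀ n, IsClosed (F n)) (hunion : (⋃ n, F n) = Set.univ)
    (hfinal : ∀ C : Set X, IsClosed C ↔
      ∀ n, IsClosed ((fun x : ↥(F n) => (x : X)) ⁻¹' C))
    (hT1 : ∀ n, T1Space ↥(F n)) :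
    ∀ (x : ℕ → X) (l : X), Filter.Tendsto x Filter.atTop (nhds l) →
      ∃ p : ℕ, ∀ k, x k ∈ F p := by
  intro x l hx
  by_contra! hcon
  have hmem : ∀ y : X, ∃ n, y ∈ F n := by
    intro y
    have hy : y ∈ ⋃ n, F n := by rw [hunion]; trivial
    exact Set.mem_iUnion.mp hy
  obtain ⟨m, hm⟩ := hmem l
  choose q hq using hmem
  have key : ∀ n, ∃ k, n ≤ k ∧ x k ∉ F (m + n) := by
    intro n
    by_contra! h
    obtain ⟨k, hk⟩ := hcon (m + n + ∑ i ∈ Finset.range n, q (x i))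
    apply hk
    by_cases hkn : n ≤ k
    · exact hmono (Nat.le_add_right _ _) (h k hkn)
    · have hle : q (x k) ≤ ∑ i ∈ Finset.range n, q (x i) :=
        Finset.single_le_sum (f := fun i => q (x i)) (fun _ _ => Nat.zero_le _)
          (Finset.mem_range.mpr (not_le.mp hkn))
      exact hmono (hle.trans (Nat.le_add_left _ _)) (hq (x k))
  choose k hk hkF using key
  have hC : IsClosed (Set.range fun n => x (k n)) := by
    rw [hfinal]
    intro n
    haveI := hT1 n
    apply Set.Finite.isClosed
    apply Set.Finite.subset (Set.Finite.preimage (Subtype.val_injective.injOn)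
      ((Set.finite_lt_nat n).image fun j => x (k j)))
    rintro ⟨y, hy⟩ ⟨j, hj⟩
    refine ⟨j, ?_, hj⟩
    by_contra hjn
    have hnj : n ≤ j := not_lt.mp hjn
    apply hkF j
    have hj' : x (k j) = y := hj
    rw [hj']
    exact hmono (hnj.trans (Nat.le_add_left _ _)) hy
  have hl : l ∈ (Set.range fun n => x (k n))ᶜ := by
    rintro ⟨j, hj⟩
    apply hkF j
    have hj' : x (k j) = l := hj
    rw [hj']
    exact hmono (Nat.le_add_right _ _) hm
  obtain ⟨N, hN⟩ := Filter.eventually_atTop.mp (hx (hC.isOpen_compl.mem_nhds hl))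
  exact hN (k N) (hk N) ⟨N, rfl⟩
end

section
/- Let K be a simplicial complex that is locally countable: every vertex of K belongs to at most countably many edges (faces with two elements). Then there exists an increasing sequence of subcomplexes K₀ ⊆ K₁ ⊆ ⋯ of K whose union is K (every face of K is a face of some Kₙ) such that each Kₙ is locally finite: every vertex of Kₙ belongs to only finitely many faces of Kₙ. -/
universe u

/-- Let `K` be a simplicial complex on a vertex set `V` (given by its set of faces:
nonempty finite sets of vertices, closed under passing to nonempty subsets) which is
locally countable: every vertex belongs to at most countably many edges.  Then `K` is
the union of an increasing sequence of subcomplexes `K₀ ⊆ K₁ ⊆ ⋯`, each of which is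
locally finite: every vertex of `Kₙ` belongs to only finitely many faces of `Kₙ`. -/
theorem locally_countable_complex_exhaustion {V : Type u} (K : Set (Finset V))
    (hne : ∀ s ∈ K, s.Nonempty)
    (hdown : ∀ s ∈ K, ∀ t : Finset V, t ⊆ s → t.Nonempty → t ∈ K)
    (hlc : ∀ v : V, ({v} : Finset V) ∈ K →
      {e ∈ K | v ∈ e ∧ e.card = 2}.Countable) :
    ∃ Ks : ℕ → Set (Finset V),
      (∀ n, Ks n ⊆ K) ∧
      Monotone Ks ∧
      (∀ n, ∀ s ∈ Ks n, ∀ t : Finset V, t ⊆ s → t.Nonempty → t ∈ Ks n) ∧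
      (⋃ n, Ks n) = K ∧
      (∀ (n : ℕ) (v : V), ({v} : Finset V) ∈ Ks n → {s ∈ Ks n | v ∈ s}.Finite) := by
  classical
  have h1 : ∀ v : V, ∃ f : Finset V → ℕ, ({v} : Finset V) ∈ K →
      Set.InjOn f {e ∈ K | v ∈ e ∧ e.card = 2} := by
    intro v
    by_cases hv : ({v} : Finset V) ∈ K
    · obtain ⟨f, hf⟩ := Set.countable_iff_exists_injOn.1 (hlc v hv)
      exact ⟨f, fun _ => hf⟩
    · exact ⟨fun _ => 0, fun h => absurd h hv⟩
  choose f hf using h1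
  refine ⟨fun n => {s ∈ K | ∀ v ∈ s, ∀ w ∈ s, f v {v, w} ≤ n}, ?_, ?_, ?_, ?_, ?_⟩
  · exact fun n s hs => hs.1
  · exact fun m n hmn s hs => ⟨hs.1, fun v hv w hw => (hs.2 v hv w hw).trans hmn⟩
  · exact fun n s hs t hts ht =>
      ⟨hdown s hs.1 t hts ht, fun v hv w hw => hs.2 v (hts hv) w (hts hw)⟩
  · ext s
    simp only [Set.mem_iUnion]
    constructor
    · rintro ⟨n, hn⟩
      exact hn.1
    · intro hs
      refine ⟨(s ×ˢ s).sup (fun p => f p.1 {p.1, p.2}), hs, fun v hv w hw => ?_⟩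
      exact Finset.le_sup (f := fun p : V × V => f p.1 {p.1, p.2}) (b := (v, w))
        (Finset.mem_product.2 ⟨hv, hw⟩)
  · intro n v hv
    have hE : {e | e ∈ {e ∈ K | v ∈ e ∧ e.card = 2} ∧ f v e ≤ n}.Finite := by
      apply Set.Finite.of_finite_image (f := f v)
      · apply (Set.finite_Iic n).subset
        rintro _ ⟨e, he, rfl⟩
        exact he.2
      · exact (hf v hv.1).mono (fun e he => he.1)
    have hW : (insert v (⋃ e ∈ {e | e ∈ {e ∈ K | v ∈ e ∧ e.card = 2} ∧ f v e ≤ n},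
        (e : Set V))).Finite :=
      (hE.biUnion (fun e _ => e.finite_toSet)).insert v
    apply (hW.toFinset.powerset.finite_toSet).subset
    rintro s ⟨hs, hvs⟩
    rw [Finset.mem_coe, Finset.mem_powerset]
    intro w hw
    rw [Set.Finite.mem_toFinset]
    by_cases hvw : w = v
    · exact Or.inl hvw
    · right
      refine Set.mem_biUnion (x := {v, w}) ⟨⟨hdown s hs.1 _ ?_ ⟨v, by simp⟩, by simp, ?_⟩,
        hs.2 v hvs w hw⟩ (by simp)
      · intro x hx
        rcases Finset.mem_insert.1 hx with rfl | hx
        · exact hvs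
        · rw [Finset.mem_singleton.1 hx]
          exact hw
      · exact Finset.card_pair (Ne.symm hvw)
end

section
/- Let X be a topological space and X₀ ⊆ X₁ ⊆ ⋯ ⊆ X an increasing sequence of closed subsets with ⋃ₙ Xₙ = X, such that X carries the final (colimit) topology with respect to the inclusions (C ⊆ X is closed iff C ∩ Xₙ is closed in Xₙ for every n), and assume each Xₙ with the subspace topology is paracompact and Hausdorff. Then X is paracompact. -/
open TopologicalSpace

universe u v w

open Set Filter Topology Function

/-- A locally finite family in a paracompact normal space has a locally finite open expansion. -/
lemma aux_expansion {Y : Type u} [TopologicalSpace Y] [ParacompactSpace Y] [NormalSpace Y]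
    {A : Type v} (W : A → Set Y) (hW : LocallyFinite W) :
    ∃ V : A → Set Y, (∀ a, IsOpen (V a)) ∧ (∀ a, W a ⊆ V a) ∧ LocallyFinite V := by
  have h1 : ∀ y : Y, ∃ O : Set Y, IsOpen O ∧ y ∈ O ∧ {a | (W a ∩ O).Nonempty}.Finite := by
    intro y
    obtain ⟨t, ht, hf⟩ := hW y
    obtain ⟨O, hOt, hO, hy⟩ := mem_nhds_iff.1 ht
    exact ⟨O, hO, hy, hf.subset fun a ha => ha.mono (inter_subset_inter_right _ hOt)⟩
  choose O hO hyO hOf using h1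
  obtain ⟨P, hPo, hPc, hPf, hPO⟩ := precise_refinement O hO
    (iUnion_eq_univ_iff.2 fun y => ⟨y, hyO y⟩)
  obtain ⟨Q, hQc, hQcl, hQP⟩ := exists_iUnion_eq_closed_subset hPo hPf.point_finite hPc
  have hQf : LocallyFinite Q := hPf.subset hQP
  refine ⟨fun a => (⋃ y : {y // Disjoint (Q y) (W a)}, Q y)ᶜ, fun a => ?_, fun a x hx => ?_, ?_⟩
  · rw [isOpen_compl_iff]
    exact (hQf.comp_injective Subtype.val_injective).isClosed_iUnion fun y => hQcl _
  · simp only [mem_compl_iff, mem_iUnion, not_exists]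
    exact fun y hy => disjoint_left.1 y.2 hy hx
  · intro y
    obtain ⟨t, ht, hf⟩ := hQf y
    refine ⟨t, ht, (hf.biUnion fun j _ => hOf j).subset ?_⟩
    rintro a ⟨x, hxV, hxt⟩
    obtain ⟨j, hj⟩ := iUnion_eq_univ_iff.1 hQc x
    refine mem_iUnion₂.2 ⟨j, ⟨x, hj, hxt⟩, ?_⟩
    by_contra hne
    apply hxV
    refine mem_iUnion.2 ⟨⟨j, ?_⟩, hj⟩
    rw [disjoint_left]
    intro z hz hzW
    exact hne ⟨z, hzW, hPO _ (hQP _ hz)⟩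

/-- Extension of a locally finite family of functions from a closed subset. -/
lemma aux_step {Y : Type u} [TopologicalSpace Y] [ParacompactSpace Y] [NormalSpace Y]
    {A : Type v} (Z : Set Y) (hZ : IsClosed Z) (U : A → Set Y) (hU : ∀ a, IsOpen (U a))
    (hUc : ∀ y, ∃ a, y ∈ U a) (g : A → Y → ℝ) (hgc : ∀ a, ContinuousOn (g a) Z)
    (hg0 : ∀ a, ∀ y ∈ Z, 0 ≤ g a y) (hgU : ∀ a, ∀ y ∈ Z, g a y ≠ 0 → y ∈ U a)
    (hgf : LocallyFinite fun a => support (g a) ∩ Z) (hgp : ∀ y ∈ Z, ∃ a, g a y ≠ 0) :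
    ∃ h : A → Y → ℝ, (∀ a, Continuous (h a)) ∧ (∀ a y, 0 ≤ h a y) ∧
      (∀ a y, h a y ≠ 0 → y ∈ U a) ∧ (LocallyFinite fun a => support (h a)) ∧
      (∀ y, ∃ a, h a y ≠ 0) ∧ ∀ a, ∀ y ∈ Z, h a y = g a y := by
  classical
  obtain ⟨V, hVo, hWV, hVf⟩ := aux_expansion _ hgf
  have hext : ∀ a, ∃ e : Y → ℝ, Continuous e ∧ (∀ y, 0 ≤ e y) ∧ (∀ y ∈ Z, e y = g a y) ∧
      ∀ y, e y ≠ 0 → y ∈ V a ∩ U a := by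
    intro a
    have hC2 : IsClosed (V a ∩ U a)ᶜ := ((hVo a).inter (hU a)).isClosed_compl
    let k : Y → ℝ := fun y => if y ∈ Z then g a y else 0
    have hk : ContinuousOn k (Z ∪ (V a ∩ U a)ᶜ) := by
      apply ContinuousOn.union_of_isClosed _ _ hZ hC2
      · exact (hgc a).congr fun y hy => by simp [k, hy]
      · refine (continuousOn_const (c := (0:ℝ))).congr fun y hy => ?_
        by_cases hyZ : y ∈ Z
        · simp only [k, hyZ, if_true]
          by_contra hne
          exact hy ⟨hWV a ⟨hne, hyZ⟩, hgU a y hyZ hne⟩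
        · simp [k, hyZ]
    obtain ⟨e, he⟩ := ContinuousMap.exists_restrict_eq (hZ.union hC2)
      (⟨_, hk.restrict⟩ : C(↥(Z ∪ (V a ∩ U a)ᶜ), ℝ))
    have he' : ∀ y ∈ Z ∪ (V a ∩ U a)ᶜ, e y = k y := fun y hy =>
      DFunLike.congr_fun he ⟨y, hy⟩
    refine ⟨fun y => |e y|, e.continuous.abs, fun y => abs_nonneg _, fun y hy => ?_, fun y hy => ?_⟩
    · simp [he' y (Or.inl hy), k, hy, abs_of_nonneg (hg0 a y hy)]
    · by_contra hn
      apply hy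
      have : k y = 0 := by
        by_cases hyZ : y ∈ Z
        · simp only [k, hyZ, if_true]
          by_contra hne
          exact hn ⟨hWV a ⟨hne, hyZ⟩, hgU a y hyZ hne⟩
        · simp [k, hyZ]
      simp [he' y (Or.inr hn), this]
  choose e hec he0 heg heV using hext
  have hD : IsClosed {y | ∀ a, e a y = 0} := by
    simp only [setOf_forall]
    exact isClosed_iInter fun a => isClosed_eq (hec a) continuous_const
  obtain ⟨p, hp⟩ := BumpCovering.exists_isSubordinate hD (fun a => U a ∩ Zᶜ)
    (fun a => (hU a).inter hZ.isOpen_compl) (by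
      intro y hy
      obtain ⟨a, ha⟩ := hUc y
      refine mem_iUnion.2 ⟨a, ha, fun hyZ => ?_⟩
      obtain ⟨b, hb⟩ := hgp y hyZ
      exact hb (by rw [← heg b y hyZ]; exact hy b))
  have hpU : ∀ a y, p a y ≠ 0 → y ∈ U a ∩ Zᶜ := fun a y hy => hp a (subset_tsupport _ hy)
  refine ⟨fun a y => e a y + p a y, fun a => (hec a).add (p a).continuous,
    fun a y => add_nonneg (he0 a y) (p.nonneg a y), fun a y hy => ?_, ?_, fun y => ?_,
    fun a y hy => ?_⟩
  · by_cases h : e a y = 0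
    · exact (hpU a y fun h' => hy (by simp [h, h'])).1
    · exact (heV a y h).2
  · have hef : LocallyFinite fun a => support (e a) := hVf.subset fun a y hy => (heV a y hy).1
    intro y
    obtain ⟨t, ht, htf⟩ := hef y
    obtain ⟨s, hs, hsf⟩ := p.locallyFinite y
    refine ⟨t ∩ s, inter_mem ht hs, (htf.union hsf).subset ?_⟩
    rintro a ⟨x, hx, hxt, hxs⟩
    by_cases h : e a x = 0
    · exact Or.inr ⟨x, fun h' => hx (by simp [h, h']), hxs⟩
    · exact Or.inl ⟨x, h, hxt⟩
  · by_cases h : ∀ a, e a y = 0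
    · refine ⟨p.ind y h, ?_⟩
      simp [h, p.ind_apply y h]
    · push Not at h
      obtain ⟨a, ha⟩ := h
      refine ⟨a, ?_⟩
      have := lt_of_le_of_ne (he0 a y) (Ne.symm ha)
      have := p.nonneg a y
      positivity
  · have : p a y = 0 := by
      by_contra hne
      exact (hpU a y hne).2 hy
    simp [this, heg a y hy]

/-- Invariant of the inductive construction. -/
structure AuxInv {X : Type u} [TopologicalSpace X] {A : Type v} (U : A → Set X) (S : Set X)
    (g : A → X → ℝ) : Prop where
  cont : ∀ a, ContinuousOn (g a) S
  nonneg : ∀ a, ∀ y ∈ S, 0 ≤ g a y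
  sub : ∀ a, ∀ y ∈ S, g a y ≠ 0 → y ∈ U a
  lf : LocallyFinite fun a => support (g a) ∩ S
  pos : ∀ y ∈ S, ∃ a, g a y ≠ 0

lemma aux_step' {X : Type u} [TopologicalSpace X] {A : Type v} (U : A → Set X)
    (hU : ∀ a, IsOpen (U a)) (hUc : ∀ y, ∃ a, y ∈ U a) (S T : Set X) (hST : S ⊆ T)
    (hS : IsClosed S) (hT : IsClosed T) (hpT : ParacompactSpace T) (hT2 : T2Space T)
    (g : A → X → ℝ) (hg : AuxInv U S g) :
    ∃ h : A → X → ℝ, AuxInv U T h ∧ ∀ a, ∀ y ∈ S, h a y = g a y := by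
  classical
  obtain ⟨h, hc, h0, hsub, hlf, hpos, heq⟩ := aux_step (Y := T) (Subtype.val ⁻¹' S)
    (hS.preimage continuous_subtype_val) (fun a => Subtype.val ⁻¹' U a)
    (fun a => (hU a).preimage continuous_subtype_val) (fun y => hUc y)
    (fun a y => g a y)
    (fun a => (hg.cont a).comp continuous_subtype_val.continuousOn fun y hy => hy)
    (fun a y hy => hg.nonneg a y hy) (fun a y hy => hg.sub a y hy)
    (hg.lf.preimage_continuous continuous_subtype_val)
    (fun y hy => hg.pos y hy)
  let k : A → X → ℝ := fun a x => if hx : x ∈ T then h a ⟨x, hx⟩ else 0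
  have hk : ∀ a (y : T), k a y = h a y := fun a y => by simp [k]
  refine ⟨k, ⟨fun a => ?_, fun a y hy => ?_, fun a y hy hne => ?_, ?_, fun y hy => ?_⟩,
    fun a y hy => ?_⟩
  · rw [continuousOn_iff_continuous_restrict]
    exact (hc a).congr fun y => (hk a y).symm
  · rw [hk a ⟨y, hy⟩]; exact h0 _ _
  · rw [hk a ⟨y, hy⟩] at hne; exact hsub _ _ hne
  · intro x
    by_cases hx : x ∈ T
    · obtain ⟨t, ht, hf⟩ := hlf ⟨x, hx⟩
      rw [nhds_subtype_eq_comap] at ht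
      obtain ⟨s, hs, hst⟩ := ht
      refine ⟨s, hs, hf.subset ?_⟩
      rintro a ⟨y, ⟨hy, hyT⟩, hys⟩
      refine ⟨⟨y, hyT⟩, ?_, hst hys⟩
      rw [mem_support, ← hk]; exact hy
    · refine ⟨Tᶜ, hT.isOpen_compl.mem_nhds hx, finite_empty.subset ?_⟩
      rintro a ⟨y, ⟨hy, hyT⟩, hys⟩
      exact hys hyT
  · obtain ⟨a, ha⟩ := hpos ⟨y, hy⟩
    exact ⟨a, by rw [hk a ⟨y, hy⟩]; exact ha⟩
  · rw [hk a ⟨y, hST hy⟩]; exact heq a ⟨y, hST hy⟩ hy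

/-- Let `X` carry the final (colimit) topology with respect to an increasing sequence of
closed subsets `X₀ ⊆ X₁ ⊆ ⋯` covering `X`, each paracompact and Hausdorff in the
subspace topology.  Then `X` is paracompact. -/
theorem colimit_of_paracompact_is_paracompact {X : Type u} [TopologicalSpace X]
    (F : ℕ → Set X)
    (hmono : Monotone F) (hclosed : ∀ n, IsClosed (F n)) (hunion : (⋃ n, F n) = Set.univ)
    (hfinal : ∀ C : Set X, IsClosed C ↔
      ∀ n, IsClosed ((fun x : ↥(F n) => (x : X)) ⁻¹' C))
    (hpara : ∀ n, ParacompactSpace ↥(F n)) (hT2 : ∀ n, T2Space ↥(F n)) :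
    ParacompactSpace X := by
  classical
  refine ⟨fun A U hU hUc => ?_⟩
  have hUc' : ∀ y, ∃ a, y ∈ U a := iUnion_eq_univ_iff.1 hUc
  have hopen : ∀ C : Set X, (∀ n, IsOpen ((fun x : ↥(F n) => (x : X)) ⁻¹' C)) → IsOpen C := by
    intro C hC
    rw [← isClosed_compl_iff, hfinal]
    intro n
    rw [preimage_compl, isClosed_compl_iff]
    exact hC n
  have hbase : ∃ g : A → X → ℝ, AuxInv U (F 0) g := by
    obtain ⟨h, hh, -⟩ := aux_step' U hU hUc' ∅ (F 0) (empty_subset _) isClosed_empty (hclosed 0)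
      (hpara 0) (hT2 0) (fun _ _ => 0)
      ⟨by simp, by simp, by simp, fun x => ⟨univ, univ_mem, by simp⟩, by simp⟩
    exact ⟨h, hh⟩
  have hstep : ∀ n (g : {g : A → X → ℝ // AuxInv U (F n) g}),
      ∃ h : {g : A → X → ℝ // AuxInv U (F (n+1)) g}, ∀ a, ∀ y ∈ F n, h.1 a y = g.1 a y := by
    rintro n ⟨g, hg⟩
    obtain ⟨h, hh, hh'⟩ := aux_step' U hU hUc' (F n) (F (n+1)) (hmono n.le_succ) (hclosed n)
      (hclosed (n+1)) (hpara _) (hT2 _) g hg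
    exact ⟨⟨h, hh⟩, hh'⟩
  choose next hnext using hstep
  obtain ⟨g0, hg0⟩ := hbase
  let G : ∀ n, {g : A → X → ℝ // AuxInv U (F n) g} := fun n => Nat.rec ⟨g0, hg0⟩ next n
  have hG : ∀ n a, ∀ y ∈ F n, (G (n+1)).1 a y = (G n).1 a y := fun n => hnext n (G n)
  have hG' : ∀ n m, n ≤ m → ∀ a, ∀ y ∈ F n, (G m).1 a y = (G n).1 a y := by
    intro n m hnm
    induction m, hnm using Nat.le_induction with
    | base => intro a y _; rfl
    | succ m hm ih =>
      intro a y hy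
      rw [hG m a y (hmono hm hy), ih a y hy]
  choose N hN using iUnion_eq_univ_iff.1 hunion
  let f : A → X → ℝ := fun a x => (G (N x)).1 a x
  have hf : ∀ n a, ∀ y ∈ F n, f a y = (G n).1 a y := by
    intro n a y hy
    rcases le_total (N y) n with h | h
    · exact (hG' _ _ h a y (hN y)).symm
    · exact hG' _ _ h a y hy
  have hfinv : ∀ n, AuxInv U (F n) f := by
    intro n
    have I := (G n).2
    refine ⟨fun a => (I.cont a).congr (hf n a), fun a y hy => ?_, fun a y hy => ?_, ?_,
      fun y hy => ?_⟩
    · rw [hf n a y hy]; exact I.nonneg a y hy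
    · rw [hf n a y hy]; exact I.sub a y hy
    · refine I.lf.subset fun a y hy => ⟨?_, hy.2⟩
      rw [mem_support, ← hf n a y hy.2]; exact hy.1
    · obtain ⟨a, ha⟩ := I.pos y hy
      exact ⟨a, by rwa [hf n a y hy]⟩
  have hf0 : ∀ a y, 0 ≤ f a y := fun a y => (hfinv (N y)).nonneg a y (hN y)
  have hfin : ∀ x, {a | f a x ≠ 0}.Finite := fun x =>
    ((hfinv (N x)).lf.point_finite x).subset fun a ha => ⟨ha, hN x⟩
  have hO : ∀ (c : A) (B : Set A) (r : ℝ),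
      IsOpen {y | 0 < f c y ∧ ∀ b ∈ B, r * f b y < f c y} := by
    intro c B r
    apply hopen
    intro n
    have hc : ∀ a, Continuous fun y : F n => f a y := fun a =>
      continuousOn_iff_continuous_restrict.1 ((hfinv n).cont a)
    rw [isOpen_iff_mem_nhds]
    rintro x ⟨hx1, hx2⟩
    obtain ⟨t, ht, hT⟩ := ((hfinv n).lf.preimage_continuous
      (continuous_subtype_val (p := (· ∈ F n)))) x
    have e1 : ∀ᶠ y : F n in 𝓝 x, 0 < f c y := (hc c).continuousAt.eventually_const_lt hx1
    have e2 : ∀ᶠ y : F n in 𝓝 x, ∀ b ∈ B ∩ {a | ((Subtype.val ⁻¹' (support (f a) ∩ F n)) ∩ t :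
        Set (F n)).Nonempty}, r * f b y < f c y := by
      rw [eventually_all_finite (hT.subset inter_subset_right)]
      intro b hb
      exact (continuous_const.mul (hc b)).continuousAt.eventually_lt (hc c).continuousAt
        (hx2 b hb.1)
    filter_upwards [e1, e2, ht] with y h1 h2 h3
    refine ⟨h1, fun b hb => ?_⟩
    by_cases h : f b y = 0
    · simpa [h] using h1
    · exact h2 b ⟨hb, y, ⟨h, y.2⟩, h3⟩
  refine ⟨A, fun a => {y | 0 < f a y ∧ ∀ b ∈ univ, (1/2 : ℝ) * f b y < f a y},
    fun a => hO a _ _, iUnion_eq_univ_iff.2 fun x => ?_, fun x => ?_, fun a => ⟨a, ?_⟩⟩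
  · obtain ⟨a0, ha0⟩ := (hfinv (N x)).pos x (hN x)
    obtain ⟨a, ha, hmax⟩ := exists_max_image _ (fun a => f a x) (hfin x) ⟨a0, ha0⟩
    have hpos : 0 < f a x := lt_of_le_of_ne (hf0 a x) (Ne.symm ha)
    refine ⟨a, hpos, fun b _ => ?_⟩
    by_cases h : f b x = 0
    · simpa [h] using hpos
    · have := hmax b h
      linarith
  · obtain ⟨c, hc⟩ := (hfinv (N x)).pos x (hN x)
    have hpos : 0 < f c x := lt_of_le_of_ne (hf0 c x) (Ne.symm hc)
    refine ⟨_, (hO c {a | f a x ≠ 0}ᶜ 2).mem_nhds ⟨hpos, fun b hb => ?_⟩, (hfin x).subset ?_⟩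
    · have : f b x = 0 := by simpa using hb
      simpa [this] using hpos
    · rintro b ⟨y, ⟨_, h2⟩, _, h4⟩
      by_contra hb
      have := h2 c (mem_univ _)
      have := h4 b hb
      linarith
  · rintro y ⟨hy, -⟩
    exact (hfinv (N y)).sub a y (hN y) hy.ne'
end
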